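/- arXiv:2103.02468 — 2 statements merged into one kernel-verified Lean document; each statement's English description precedes it below -/
import Mathlib

section
/- Let H be a finite-dimensional complex Hilbert space and |ψ⟩ = Σ_i √λ_i |u_i⟩|u_i⟩ ∈ H ⊗ H a unit vector, where λ_i ≥ 0 and {|u_i⟩} is an orthonormal basis of H; transposes are taken with respect to {|u_i⟩}. Let 𝒳, 𝒜 be finite sets, μ a probability distribution on 𝒳, and for each x ∈ 𝒳 let {A^x_a}_{a∈𝒜} be a projective measurement and {M^x_a}_{a∈𝒜} an arbitrary POVM on H. Set δ = 1 − E_{x∼μ} Σ_{a∈𝒜} ⟨ψ| A^x_a ⊗ (A^x_a)^T |ψ⟩ and γ = 1 − E_{x∼μ} Σ_{a∈𝒜} ⟨ψ| A^x_a ⊗ (M^x_a)^T |ψ⟩. Then (γ − δ)² ≤ E_{x∼μ} Σ_{a∈𝒜} ⟨ψ| Id ⊗ (A^x_a − M^x_a)² |ψ⟩ ≤ 2γ + 2√(2δ). -/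
open scoped Kronecker ComplexOrder
open Matrix MeasureTheory

attribute [local instance] Matrix.normedAddCommGroup Matrix.normedSpace

namespace AlmostSync

/-- Frobenius norm of a complex matrix. -/
noncomputable def frob {n : Type*} [Fintype n] (X : Matrix n n ℂ) : ℝ :=
  Real.sqrt ((Xᴴ * X).trace.re)

/-- `⟨ψ| M |ψ⟩` (real part). -/
noncomputable def ev {m : Type*} [Fintype m] (ψ : m → ℂ) (M : Matrix m m ℂ) : ℝ :=
  (star ψ ⬝ᵥ M.mulVec ψ).re

/-- Squared `ℓ²` norm of a vector. -/
noncomputable def nsq {m : Type*} [Fintype m] (v : m → ℂ) : ℝ :=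
  ∑ p, Complex.normSq (v p)

/-- A probability distribution on a finite set. -/
def IsDist {𝒳 : Type*} [Fintype 𝒳] (ν : 𝒳 → ℝ) : Prop :=
  (∀ x, 0 ≤ ν x) ∧ ∑ x, ν x = 1

/-- A POVM on a finite-dimensional space. -/
def IsPOVM {n 𝒜 : Type*} [Fintype n] [DecidableEq n] [Fintype 𝒜]
    (A : 𝒜 → Matrix n n ℂ) : Prop :=
  (∀ a, (A a).PosSemidef) ∧ ∑ a, A a = 1

/-- A projective measurement. -/
def IsProjMeas {n 𝒜 : Type*} [Fintype n] [DecidableEq n] [Fintype 𝒜]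
    (A : 𝒜 → Matrix n n ℂ) : Prop :=
  (∀ a, (A a)ᴴ = A a ∧ A a * A a = A a) ∧ ∑ a, A a = 1

/-- A projective measurement supported on the range of a projection `P`. -/
def IsProjMeasOn {n 𝒜 : Type*} [Fintype n] [DecidableEq n] [Fintype 𝒜]
    (P : Matrix n n ℂ) (A : 𝒜 → Matrix n n ℂ) : Prop :=
  (∀ a, (A a)ᴴ = A a ∧ A a * A a = A a ∧ P * A a = A a ∧ A a * P = A a) ∧ ∑ a, A a = P

/-- The state `Σ_i √(lam i) |i⟩|i⟩` (standard basis as eigenbasis). -/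
noncomputable def canonPsi {n : Type*} [DecidableEq n] (lam : n → ℝ) : n × n → ℂ :=
  fun p => if p.1 = p.2 then (Real.sqrt (lam p.1) : ℂ) else 0

/-- The maximally entangled state `d^{-1/2} Σ_i |i⟩|i⟩`. -/
noncomputable def mePsi (d : ℕ) : Fin d × Fin d → ℂ :=
  fun p => if p.1 = p.2 then ((Real.sqrt d)⁻¹ : ℂ) else 0

/-- Default to synchronicity `E_{x∼ν} Σ_{a≠b} ⟨ψ| A^x_a ⊗ B^x_b |ψ⟩`. -/
noncomputable def deltaSync {n₁ n₂ 𝒳 𝒜 : Type*} [Fintype n₁] [Fintype n₂]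
    [Fintype 𝒳] [Fintype 𝒜] [DecidableEq 𝒜]
    (ν : 𝒳 → ℝ) (ψ : n₁ × n₂ → ℂ)
    (A : 𝒳 → 𝒜 → Matrix n₁ n₁ ℂ) (B : 𝒳 → 𝒜 → Matrix n₂ n₂ ℂ) : ℝ :=
  ∑ x, ν x * ∑ a, ∑ b, if a = b then 0 else ev ψ (A x a ⊗ₖ B x b)

/-- The correlation induced by a strategy. -/
noncomputable def corr {n₁ n₂ 𝒳 𝒴 𝒜 ℬ : Type*} [Fintype n₁] [Fintype n₂]
    (ψ : n₁ × n₂ → ℂ) (A : 𝒳 → 𝒜 → Matrix n₁ n₁ ℂ) (B : 𝒴 → ℬ → Matrix n₂ n₂ ℂ)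
    (x : 𝒳) (y : 𝒴) (a : 𝒜) (b : ℬ) : ℝ :=
  ev ψ (A x a ⊗ₖ B y b)

/-- Success probability of a strategy in a nonlocal game. -/
noncomputable def winProb {n₁ n₂ 𝒳 𝒴 𝒜 ℬ : Type*} [Fintype n₁] [Fintype n₂]
    [Fintype 𝒳] [Fintype 𝒴] [Fintype 𝒜] [Fintype ℬ]
    (ν : 𝒳 × 𝒴 → ℝ) (D : 𝒳 → 𝒴 → 𝒜 → ℬ → Bool)
    (ψ : n₁ × n₂ → ℂ) (A : 𝒳 → 𝒜 → Matrix n₁ n₁ ℂ) (B : 𝒴 → ℬ → Matrix n₂ n₂ ℂ) : ℝ :=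
  ∑ x, ∑ y, ν (x, y) * ∑ a, ∑ b, (if D x y a b then (1:ℝ) else 0) * ev ψ (A x a ⊗ₖ B y b)

/-- Reduced density operator on the first tensor factor. -/
noncomputable def rhoA {n₁ n₂ : Type*} [Fintype n₂] (ψ : n₁ × n₂ → ℂ) : Matrix n₁ n₁ ℂ :=
  Matrix.of fun i i' => ∑ j, ψ (i, j) * star (ψ (i', j))

/-- Reduced density operator on the second tensor factor. -/
noncomputable def rhoB {n₁ n₂ : Type*} [Fintype n₁] (ψ : n₁ × n₂ → ℂ) : Matrix n₂ n₂ ℂ :=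
  Matrix.of fun j j' => ∑ i, ψ (i, j) * star (ψ (i, j'))

/-- Transpose with respect to the orthonormal basis given by the columns of a unitary `U`. -/
noncomputable def transposeB {n : Type*} [Fintype n] (U X : Matrix n n ℂ) : Matrix n n ℂ :=
  U * (Uᴴ * X * U)ᵀ * Uᴴ

/-- Canonical purification `Σ_k √(lam k) |u_k⟩|u_k⟩` of `U * diagonal lam * Uᴴ`,
where `u_k` is the `k`-th column of `U`. -/
noncomputable def purif {n : Type*} [Fintype n] (U : Matrix n n ℂ) (lam : n → ℝ) :
    n × n → ℂ :=
  fun p => ∑ k, (Real.sqrt (lam k) : ℂ) * U p.1 k * U p.2 k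

/-- Spectral projection of a Hermitian matrix onto eigenvalues `≥ t`
(the indicator of `[t, ∞)` applied via the functional calculus). -/
noncomputable def specProj {n : Type*} [Fintype n] [DecidableEq n] {M : Matrix n n ℂ}
    (hM : M.IsHermitian) (t : ℝ) : Matrix n n ℂ :=
  hM.cfc (fun x => if t ≤ x then 1 else 0)

/-- Spectral projection at level `t` of the diagonal matrix with entries `lam`. -/
noncomputable def Pdiag {n : Type*} [Fintype n] [DecidableEq n] (lam : n → ℝ) (t : ℝ) :
    Matrix n n ℂ :=
  Matrix.diagonal (fun i => if t ≤ lam i then 1 else 0)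

/-- `ψ` is the maximally entangled state on `H' ⊗ H'` where `H'` is the range of the
projection `P`. -/
def IsMaxEntOn {n : Type*} [Fintype n] [DecidableEq n] (ψ : n × n → ℂ)
    (P : Matrix n n ℂ) : Prop :=
  ∃ (S : Finset n) (v : n → n → ℂ),
    (∀ i ∈ S, ∀ j ∈ S, star (v i) ⬝ᵥ v j = if i = j then 1 else 0) ∧
    P = ∑ i ∈ S, Matrix.vecMulVec (v i) (star (v i)) ∧
    ψ = fun p => ((Real.sqrt S.card)⁻¹ : ℂ) * ∑ i ∈ S, v i p.1 * v i p.2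

lemma rhoA_isHermitian {n₁ n₂ : Type*} [Fintype n₂] (ψ : n₁ × n₂ → ℂ) :
    (rhoA ψ).IsHermitian := by
  refine Matrix.ext fun i j => ?_
  simp only [rhoA, Matrix.conjTranspose_apply, Matrix.of_apply, star_sum, star_mul',
    star_star]
  exact Finset.sum_congr rfl fun k _ => mul_comm _ _

lemma rhoB_isHermitian {n₁ n₂ : Type*} [Fintype n₁] (ψ : n₁ × n₂ → ℂ) :
    (rhoB ψ).IsHermitian := by
  refine Matrix.ext fun i j => ?_
  simp only [rhoB, Matrix.conjTranspose_apply, Matrix.of_apply, star_sum, star_mul',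
    star_star]
  exact Finset.sum_congr rfl fun k _ => mul_comm _ _


/-- `Re tr(Xᴴ Y)`, the real Hilbert–Schmidt inner product. -/
noncomputable def hs {n : Type*} [Fintype n] (X Y : Matrix n n ℂ) : ℝ :=
  (Xᴴ * Y).trace.re

lemma hs_self_nonneg {n : Type*} [Fintype n] (X : Matrix n n ℂ) : 0 ≤ hs X X :=
  (Complex.le_def.mp (posSemidef_conjTranspose_mul_self X).trace_nonneg).1

lemma hs_comm {n : Type*} [Fintype n] (X Y : Matrix n n ℂ) : hs X Y = hs Y X := by
  have h : (Yᴴ * X).trace = star (Xᴴ * Y).trace := by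
    rw [← trace_conjTranspose, conjTranspose_mul, conjTranspose_conjTranspose]
  simp [hs, h]

lemma hs_add_smul_self {n : Type*} [Fintype n] (X Y : Matrix n n ℂ) (t : ℝ) :
    hs (X + (t : ℂ) • Y) (X + (t : ℂ) • Y) = hs Y Y * (t * t) + 2 * hs X Y * t + hs X X := by
  have h := hs_comm X Y
  simp only [hs] at h ⊢
  simp [Matrix.add_mul, Matrix.mul_add, trace_add]
  rw [← h]
  ring

/-- Cauchy–Schwarz for a weighted family of Hilbert–Schmidt inner products. -/
lemma sq_sum_hs_le {n 𝒳 𝒜 : Type*} [Fintype n] [Fintype 𝒳] [Fintype 𝒜]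
    (μ : 𝒳 → ℝ) (hμ : ∀ x, 0 ≤ μ x) (X Y : 𝒳 → 𝒜 → Matrix n n ℂ) :
    (∑ x, μ x * ∑ a, hs (X x a) (Y x a)) ^ 2 ≤
      (∑ x, μ x * ∑ a, hs (X x a) (X x a)) * ∑ x, μ x * ∑ a, hs (Y x a) (Y x a) := by
  have h := discrim_le_zero (K := ℝ) (a := ∑ x, μ x * ∑ a, hs (Y x a) (Y x a))
    (b := 2 * ∑ x, μ x * ∑ a, hs (X x a) (Y x a))
    (c := ∑ x, μ x * ∑ a, hs (X x a) (X x a)) fun t => by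
      have h0 : 0 ≤ ∑ x, μ x * ∑ a, hs (X x a + (t : ℂ) • Y x a) (X x a + (t : ℂ) • Y x a) :=
        Finset.sum_nonneg fun x _ => mul_nonneg (hμ x)
          (Finset.sum_nonneg fun a _ => hs_self_nonneg _)
      refine h0.trans_eq ?_
      simp only [hs_add_smul_self, Finset.sum_add_distrib, ← Finset.sum_mul, ← Finset.mul_sum,
        mul_add]
      congr 2
      · rw [Finset.sum_mul]
        exact Finset.sum_congr rfl fun x _ => by ring
      · rw [Finset.mul_sum, Finset.sum_mul]
        exact Finset.sum_congr rfl fun x _ => by ring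
  rw [discrim] at h
  nlinarith

/-- The diagonal matrix of Schmidt coefficients, i.e. the square root of the reduced state. -/
noncomputable def sqrtDiag {n : Type*} [DecidableEq n] (lam : n → ℝ) : Matrix n n ℂ :=
  Matrix.diagonal fun i => (Real.sqrt (lam i) : ℂ)

lemma conjTranspose_sqrtDiag {n : Type*} [DecidableEq n] (lam : n → ℝ) :
    (sqrtDiag lam)ᴴ = sqrtDiag lam := by
  simp only [sqrtDiag, diagonal_conjTranspose]
  congr 1
  ext i
  simp

lemma hs_sqrtDiag_self {n : Type*} [Fintype n] [DecidableEq n] (lam : n → ℝ)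
    (hlam : ∀ i, 0 ≤ lam i) : hs (sqrtDiag lam) (sqrtDiag lam) = ∑ i, lam i := by
  simp only [hs, conjTranspose_sqrtDiag]
  simp only [sqrtDiag, diagonal_mul_diagonal, trace_diagonal, Complex.re_sum]
  refine Finset.sum_congr rfl fun i _ => ?_
  rw [← Complex.ofReal_mul, Complex.ofReal_re, Real.mul_self_sqrt (hlam i)]

lemma ev_canonPsi_kronecker {n : Type*} [Fintype n] [DecidableEq n] (lam : n → ℝ)
    (A B : Matrix n n ℂ) :
    ev (canonPsi lam) (A ⊗ₖ Bᵀ) = (A * sqrtDiag lam * B * sqrtDiag lam).trace.re := by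
  unfold ev
  congr 1
  simp only [dotProduct, mulVec, Fintype.sum_prod_type, canonPsi, sqrtDiag, trace, diag_apply,
    Matrix.mul_apply, kroneckerMap_apply, transpose_apply, Pi.star_apply]
  simp [apply_ite, Finset.sum_mul, Finset.mul_sum, Matrix.diagonal_apply, ite_mul]
  exact Finset.sum_congr rfl fun i _ => Finset.sum_congr rfl fun j _ => by ring

lemma ev_canonPsi_one_kronecker {n : Type*} [Fintype n] [DecidableEq n] (lam : n → ℝ)
    (B : Matrix n n ℂ) :
    ev (canonPsi lam) ((1 : Matrix n n ℂ) ⊗ₖ B) = (sqrtDiag lam * B * sqrtDiag lam).trace.re := by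
  have h := ev_canonPsi_kronecker lam 1 Bᵀ
  rw [transpose_transpose, Matrix.one_mul] at h
  rw [h, ← trace_transpose]
  simp [sqrtDiag, Matrix.mul_assoc]

/-- An effect dominates its square. -/
lemma posSemidef_sub_mul_self {n : Type*} [Fintype n] [DecidableEq n] {M : Matrix n n ℂ}
    (h0 : M.PosSemidef) (h1 : (1 - M).PosSemidef) : (M - M * M).PosSemidef := by
  have h : M - M * M = Mᴴ * (1 - M) * M + (1 - M)ᴴ * M * (1 - M) := by
    rw [h0.1.eq, h1.1.eq]
    noncomm_ring
  rw [h]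
  exact (h1.conjTranspose_mul_mul_same M).add (h0.conjTranspose_mul_mul_same (1 - M))

lemma IsPOVM.one_sub_posSemidef {n 𝒜 : Type*} [Fintype n] [DecidableEq n] [Fintype 𝒜]
    {M : 𝒜 → Matrix n n ℂ} (hM : IsPOVM M) (a : 𝒜) : (1 - M a).PosSemidef := by
  classical
  rw [← hM.2, ← Finset.sum_erase_eq_sub (Finset.mem_univ a)]
  exact posSemidef_sum _ fun b _ => hM.1 b

lemma sum_hs_mul_left {n 𝒜 : Type*} [Fintype n] [DecidableEq n] [Fintype 𝒜]
    {A : 𝒜 → Matrix n n ℂ} (hA : ∑ a, A a = 1) (K : Matrix n n ℂ) :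
    ∑ a, hs K (A a * K) = hs K K := by
  simp only [hs]
  rw [← Complex.re_sum, ← trace_sum, ← Finset.mul_sum, ← Finset.sum_mul, hA, Matrix.one_mul]

/-- A projective measurement satisfies `∑ ‖A_a K‖² = ‖K‖²`. -/
lemma IsProjMeas.sum_hs_mul_self {n 𝒜 : Type*} [Fintype n] [DecidableEq n] [Fintype 𝒜]
    {A : 𝒜 → Matrix n n ℂ} (hA : IsProjMeas A) (K : Matrix n n ℂ) :
    ∑ a, hs (A a * K) (A a * K) = hs K K := by
  rw [← sum_hs_mul_left hA.2 K]
  refine Finset.sum_congr rfl fun a _ => ?_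
  rw [hs, hs, conjTranspose_mul, (hA.1 a).1, Matrix.mul_assoc, ← Matrix.mul_assoc (A a),
    (hA.1 a).2]

/-- A POVM satisfies `∑ ‖M_a K‖² ≤ ‖K‖²`. -/
lemma IsPOVM.sum_hs_mul_self_le {n 𝒜 : Type*} [Fintype n] [DecidableEq n] [Fintype 𝒜]
    {M : 𝒜 → Matrix n n ℂ} (hM : IsPOVM M) (K : Matrix n n ℂ) :
    ∑ a, hs (M a * K) (M a * K) ≤ hs K K := by
  rw [← sum_hs_mul_left hM.2 K]
  refine Finset.sum_le_sum fun a _ => ?_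
  have h := (Complex.le_def.mp ((posSemidef_sub_mul_self (hM.1 a)
    (hM.one_sub_posSemidef a)).conjTranspose_mul_mul_same K).trace_nonneg).1
  simp only [hs, conjTranspose_mul, (hM.1 a).1.eq]
  simp only [Matrix.mul_sub, Matrix.sub_mul, trace_sub, Complex.sub_re, Complex.zero_re] at h
  simp only [Matrix.mul_assoc] at h ⊢
  linarith

/-- comparison of two state-dependent distances between measurements
(Lemma `am-cons`): `(γ − δ)² ≤ E_{x∼μ} Σ_a ⟨ψ| Id ⊗ (A^x_a − M^x_a)² |ψ⟩ ≤ 2γ + 2√(2δ)`. -/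
theorem stmt2 {n 𝒳 𝒜 : Type*} [Fintype n] [DecidableEq n] [Fintype 𝒳] [Fintype 𝒜]
    (lam : n → ℝ) (hlam : ∀ i, 0 ≤ lam i) (hlam1 : ∑ i, lam i = 1)
    (μ : 𝒳 → ℝ) (hμ : IsDist μ)
    (A M : 𝒳 → 𝒜 → Matrix n n ℂ)
    (hA : ∀ x, IsProjMeas (A x)) (hM : ∀ x, IsPOVM (M x))
    (δ γ : ℝ)
    (hδ : δ = 1 - ∑ x, μ x * ∑ a, ev (canonPsi lam) (A x a ⊗ₖ (A x a)ᵀ))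
    (hγ : γ = 1 - ∑ x, μ x * ∑ a, ev (canonPsi lam) (A x a ⊗ₖ (M x a)ᵀ)) :
    (γ - δ) ^ 2 ≤
      ∑ x, μ x * ∑ a, ev (canonPsi lam)
        ((1 : Matrix n n ℂ) ⊗ₖ ((A x a - M x a) * (A x a - M x a)))
    ∧ ∑ x, μ x * ∑ a, ev (canonPsi lam)
        ((1 : Matrix n n ℂ) ⊗ₖ ((A x a - M x a) * (A x a - M x a)))
      ≤ 2 * γ + 2 * Real.sqrt (2 * δ) := by
  set K := sqrtDiag lam with hKdef
  have hKH : Kᴴ = K := conjTranspose_sqrtDiag lam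
  have hK1 : hs K K = 1 := (hs_sqrtDiag_self lam hlam).trans hlam1
  have hAH x a : (A x a)ᴴ = A x a := ((hA x).1 a).1
  have hMH x a : (M x a)ᴴ = M x a := ((hM x).1 a).1.eq
  have hev x a (B : Matrix n n ℂ) :
      ev (canonPsi lam) (A x a ⊗ₖ Bᵀ) = hs (A x a * K) (K * B) := by
    rw [ev_canonPsi_kronecker, hs, conjTranspose_mul, hAH, hKH, ← hKdef, trace_mul_comm]
    simp only [Matrix.mul_assoc]
  have hS x a : ev (canonPsi lam) ((1 : Matrix n n ℂ) ⊗ₖ ((A x a - M x a) * (A x a - M x a)))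
      = hs ((A x a - M x a) * K) ((A x a - M x a) * K) := by
    rw [ev_canonPsi_one_kronecker, hs, conjTranspose_mul, conjTranspose_sub, hAH, hMH, hKH]
    simp only [Matrix.mul_assoc, ← hKdef]
  have hAA : ∑ x, μ x * ∑ a, hs (A x a * K) (A x a * K) = 1 := by
    simp only [(hA _).sum_hs_mul_self, hK1, mul_one, hμ.2]
  have hMM : ∑ x, μ x * ∑ a, hs (M x a * K) (M x a * K) ≤ 1 := by
    rw [← hμ.2]
    refine Finset.sum_le_sum fun x _ => mul_le_of_le_one_right (hμ.1 x) ?_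
    exact hK1 ▸ (hM x).sum_hs_mul_self_le K
  simp only [hev] at hδ hγ
  simp only [hS]
  constructor
  · have h := sq_sum_hs_le μ hμ.1 (fun x a => A x a * K) (fun x a => K * (A x a - M x a))
    have e1 : ∑ x, μ x * ∑ a, hs (A x a * K) (K * (A x a - M x a)) = γ - δ := by
      rw [hγ, hδ]
      simp only [hs, trace_sub, Complex.sub_re, Finset.sum_sub_distrib,
        mul_sub]
      ring
    have e2 x a : hs (K * (A x a - M x a)) (K * (A x a - M x a))
        = hs ((A x a - M x a) * K) ((A x a - M x a) * K) := by
      simp only [hs, conjTranspose_mul, conjTranspose_sub, hAH, hMH, hKH]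
      rw [trace_mul_comm]
    simpa only [e1, e2, hAA, one_mul] using h
  · have hcs := sq_sum_hs_le μ hμ.1 (fun x a => A x a * K - K * A x a) (fun x a => M x a * K)
    have hcomm : ∑ x, μ x * ∑ a, hs (A x a * K - K * A x a) (A x a * K - K * A x a) = 2 * δ := by
      have h x a : hs (A x a * K - K * A x a) (A x a * K - K * A x a)
          = 2 * hs (A x a * K) (A x a * K) - 2 * hs (A x a * K) (K * A x a) := by
        simp only [hs, conjTranspose_mul, conjTranspose_sub, hAH, hKH, Matrix.mul_sub,
          Matrix.sub_mul, trace_sub, Complex.sub_re]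
        have h1 : (A x a * K * (K * A x a)).trace = (K * A x a * (A x a * K)).trace :=
          trace_mul_comm _ _
        have h2 : (A x a * K * (A x a * K)).trace = (K * A x a * (K * A x a)).trace := by
          rw [Matrix.mul_assoc, trace_mul_comm]
          simp only [Matrix.mul_assoc]
        rw [h1, h2]
        ring
      simp only [h, Finset.sum_sub_distrib, ← Finset.mul_sum, mul_sub, mul_left_comm _ (2 : ℝ),
        hAA]
      linarith
    have hexp : ∑ x, μ x * ∑ a, hs ((A x a - M x a) * K) ((A x a - M x a) * K)
        = 1 + ∑ x, μ x * ∑ a, hs (M x a * K) (M x a * K) - 2 * (1 - γ)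
          - 2 * ∑ x, μ x * ∑ a, hs (A x a * K - K * A x a) (M x a * K) := by
      have h x a : hs ((A x a - M x a) * K) ((A x a - M x a) * K)
          = hs (A x a * K) (A x a * K) + hs (M x a * K) (M x a * K)
            - 2 * hs (A x a * K) (K * M x a)
            - 2 * hs (A x a * K - K * A x a) (M x a * K) := by
        have h1 := hs_comm (A x a * K) (M x a * K)
        have h2 : hs (A x a * K) (K * M x a) = hs (K * A x a) (M x a * K) := by
          simp only [hs, conjTranspose_mul, hAH, hKH]
          conv_rhs => rw [← Matrix.mul_assoc, trace_mul_comm]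
          simp only [Matrix.mul_assoc]
        rw [h2]
        simp only [hs, conjTranspose_mul, conjTranspose_sub, hAH, hMH, hKH, Matrix.mul_sub,
          Matrix.sub_mul, trace_sub, Complex.sub_re] at h1 ⊢
        linarith
      have hγ' : 1 - γ = ∑ x, μ x * ∑ a, hs (A x a * K) (K * M x a) := by linarith
      simp only [h, Finset.sum_sub_distrib, Finset.sum_add_distrib, ← Finset.mul_sum, mul_sub,
        mul_add, mul_left_comm _ (2 : ℝ), hAA, hγ']
    have hδ0 : 0 ≤ 2 * δ := hcomm ▸ Finset.sum_nonneg fun x _ => mul_nonneg (hμ.1 x)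
      (Finset.sum_nonneg fun a _ => hs_self_nonneg _)
    have hb : -Real.sqrt (2 * δ)
        ≤ ∑ x, μ x * ∑ a, hs (A x a * K - K * A x a) (M x a * K) := by
      refine Real.neg_sqrt_le_of_sq_le (hcs.trans ?_)
      rw [hcomm]
      exact mul_le_of_le_one_right hδ0 hMM
    linarith

end AlmostSync
end

section
/- Let |ψ⟩ ∈ H_A ⊗ H_B be a unit vector, and let {A_a}_{a∈𝒜} and {B_a}_{a∈𝒜} be POVMs on the finite-dimensional complex Hilbert spaces H_A and H_B respectively. Let ρ_A and ρ_B be the reduced density operators of |ψ⟩ on H_A and H_B, and let |ψ_A⟩ ∈ H_A ⊗ H_A and |ψ_B⟩ ∈ H_B ⊗ H_B be the canonical purifications of ρ_A and ρ_B. Then Σ_a ⟨ψ| A_a ⊗ B_a |ψ⟩ ≤ (Σ_a ⟨ψ_A| A_a ⊗ A_a^T |ψ_A⟩)^{1/2} · (Σ_a ⟨ψ_B| B_a ⊗ B_a^T |ψ_B⟩)^{1/2}, where each transpose is taken with respect to the eigenbasis used in the corresponding canonical purification. -/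
open scoped Kronecker ComplexOrder
open Matrix MeasureTheory

attribute [local instance] Matrix.normedAddCommGroup Matrix.normedSpace

namespace AlmostSync

/-- The coefficient matrix of a bipartite vector. -/
def coeffMat {m n : Type*} (ψ : m × n → ℂ) : Matrix m n ℂ :=
  Matrix.of fun i j => ψ (i, j)

lemma rhoA_eq_coeffMat {m n : Type*} [Fintype n] (ψ : m × n → ℂ) :
    rhoA ψ = coeffMat ψ * (coeffMat ψ)ᴴ := by
  ext i j
  simp [rhoA, coeffMat, Matrix.mul_apply]

lemma rhoB_eq_coeffMat {m n : Type*} [Fintype m] (ψ : m × n → ℂ) :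
    rhoB ψ = ((coeffMat ψ)ᴴ * coeffMat ψ)ᵀ := by
  ext i j
  simp [rhoB, coeffMat, Matrix.mul_apply, mul_comm]

lemma coeffMat_kronecker_mulVec {m n : Type*} [Fintype m] [Fintype n]
    (U : Matrix m m ℂ) (V : Matrix n n ℂ) (ψ : m × n → ℂ) :
    coeffMat ((U ⊗ₖ V) *ᵥ ψ) = U * coeffMat ψ * Vᵀ := by
  ext i j
  simp only [coeffMat, Matrix.mul_apply, Matrix.of_apply, Matrix.mulVec, dotProduct,
    Matrix.kroneckerMap_apply, Matrix.transpose_apply, Finset.sum_mul, Fintype.sum_prod_type]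
  rw [Finset.sum_comm]
  exact Finset.sum_congr rfl fun _ _ => Finset.sum_congr rfl fun _ _ => by ring

lemma ev_kronecker {m n : Type*} [Fintype m] [Fintype n]
    (A : Matrix m m ℂ) (B : Matrix n n ℂ) (ψ : m × n → ℂ) :
    ev ψ (A ⊗ₖ B) = ((A * coeffMat ψ * Bᵀ) * (coeffMat ψ)ᴴ).trace.re := by
  rw [← coeffMat_kronecker_mulVec]
  simp [ev, Matrix.trace, Matrix.mul_apply, dotProduct, coeffMat, Fintype.sum_prod_type, mul_comm]

lemma ev_mulVec {m n : Type*} [Fintype m] [Fintype n] (M : Matrix m n ℂ) (v : n → ℂ)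
    (X : Matrix m m ℂ) : ev (M *ᵥ v) X = ev v (Mᴴ * X * M) := by
  simp only [ev, Matrix.star_mulVec, Matrix.mulVec_mulVec, ← Matrix.dotProduct_mulVec,
    Matrix.mul_assoc]

lemma purif_eq_mulVec {n : Type*} [Fintype n] [DecidableEq n] (U : Matrix n n ℂ) (lam : n → ℝ) :
    purif U lam = (U ⊗ₖ U) *ᵥ canonPsi lam := by
  ext p
  simp only [purif, canonPsi, Matrix.mulVec, dotProduct, Matrix.kroneckerMap_apply,
    Fintype.sum_prod_type, mul_ite, mul_zero, Finset.sum_ite_eq, Finset.mem_univ, if_true]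
  exact Finset.sum_congr rfl fun _ _ => by ring

lemma coeffMat_canonPsi {n : Type*} [DecidableEq n] (lam : n → ℝ) :
    coeffMat (canonPsi lam) = Matrix.diagonal fun i => (Real.sqrt (lam i) : ℂ) := by
  ext i j
  simp [coeffMat, canonPsi, Matrix.diagonal_apply]

lemma ev_canonPsi {n : Type*} [Fintype n] [DecidableEq n] (lam : n → ℝ)
    {X : Matrix n n ℂ} (hX : X.IsHermitian) :
    ev (canonPsi lam) (X ⊗ₖ Xᵀ) =
      ∑ i, ∑ j, Real.sqrt (lam i) * Real.sqrt (lam j) * Complex.normSq (X i j) := by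
  rw [ev_kronecker, coeffMat_canonPsi, Matrix.trace, Complex.re_sum]
  refine Finset.sum_congr rfl fun i _ => ?_
  simp only [Matrix.diag_apply, Matrix.transpose_transpose, Matrix.diagonal_conjTranspose,
    Matrix.mul_diagonal, Matrix.mul_apply (M := X * _), Finset.sum_mul, Complex.re_sum]
  refine Finset.sum_congr rfl fun j _ => ?_
  rw [← hX.apply j i, Pi.star_apply, RCLike.star_def, Complex.conj_ofReal,
    mul_right_comm (X i j), Complex.mul_conj]
  norm_cast
  ring

lemma ev_purif {n : Type*} [Fintype n] [DecidableEq n] {U : Matrix n n ℂ} (hU : Uᴴ * U = 1)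
    (lam : n → ℝ) {X : Matrix n n ℂ} (hX : X.IsHermitian) :
    ev (purif U lam) (X ⊗ₖ transposeB U X) =
      ∑ i, ∑ j, Real.sqrt (lam i) * Real.sqrt (lam j) * Complex.normSq ((Uᴴ * X * U) i j) := by
  have h : Uᴴ * transposeB U X * U = (Uᴴ * X * U)ᵀ := by
    rw [transposeB, ← Matrix.mul_assoc, ← Matrix.mul_assoc, hU, Matrix.one_mul, Matrix.mul_assoc,
      hU, Matrix.mul_one]
  rw [purif_eq_mulVec, ev_mulVec, Matrix.conjTranspose_kronecker, ← Matrix.mul_kronecker_mul,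
    ← Matrix.mul_kronecker_mul, h, ev_canonPsi _ (Matrix.isHermitian_conjTranspose_mul_mul U hX)]

lemma sum_normSq_mul_le {l m n : Type*} [Fintype l] [Fintype m] [Fintype n] [DecidableEq m]
    (X : Matrix l m ℂ) {W : Matrix m n ℂ} {d : m → ℝ}
    (hW : W * Wᴴ = Matrix.diagonal fun i => (d i : ℂ)) (hd : ∀ i, d i ≤ 1) :
    ∑ i, ∑ j, Complex.normSq ((X * W) i j) ≤ ∑ i, ∑ j, Complex.normSq (X i j) := by
  refine Finset.sum_le_sum fun i _ => ?_
  have hrow : ∀ {k : Type _} [Fintype k] (Y : Matrix l k ℂ),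
      ((Y * Yᴴ) i i) = ((∑ j, Complex.normSq (Y i j) : ℝ) : ℂ) := by
    intro k _ Y
    simp [Matrix.mul_apply, Complex.mul_conj]
  have h : ∑ j, Complex.normSq ((X * W) i j) = ∑ j, d j * Complex.normSq (X i j) := by
    apply Complex.ofReal_injective
    rw [← hrow, Matrix.conjTranspose_mul, Matrix.mul_assoc, ← Matrix.mul_assoc W, hW,
      ← Matrix.mul_assoc, Matrix.mul_apply]
    push_cast
    refine Finset.sum_congr rfl fun j _ => ?_
    rw [Matrix.mul_diagonal, Matrix.conjTranspose_apply, RCLike.star_def, mul_right_comm,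
      Complex.mul_conj, mul_comm]
  rw [h]
  exact Finset.sum_le_sum fun j _ => mul_le_of_le_one_left (Complex.normSq_nonneg _) (hd j)

lemma sum_re_trace_mul_le {ι m n : Type*} [Fintype ι] [Fintype m] [Fintype n]
    (P : ι → Matrix m n ℂ) (Q : ι → Matrix n m ℂ) :
    ∑ a, (P a * Q a).trace.re ≤
      Real.sqrt (∑ a, ∑ i, ∑ j, Complex.normSq (P a i j)) *
      Real.sqrt (∑ a, ∑ j, ∑ i, Complex.normSq (Q a j i)) := by
  have h := Real.sum_mul_le_sqrt_mul_sqrt (Finset.univ : Finset (ι × m × n))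
    (fun x => ‖P x.1 x.2.1 x.2.2‖) (fun x => ‖Q x.1 x.2.2 x.2.1‖)
  simp only [Fintype.sum_prod_type, ← Complex.normSq_eq_norm_sq] at h
  have hQ : ∑ a, ∑ j, ∑ i, Complex.normSq (Q a j i) = ∑ a, ∑ i, ∑ j, Complex.normSq (Q a j i) :=
    Finset.sum_congr rfl fun a _ => Finset.sum_comm
  rw [hQ]
  refine le_trans ?_ h
  simp only [Matrix.trace, Matrix.diag_apply, Matrix.mul_apply, Complex.re_sum]
  refine Finset.sum_le_sum fun a _ => Finset.sum_le_sum fun i _ => Finset.sum_le_sum fun j _ => ?_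
  exact (Complex.re_le_norm _).trans (norm_mul _ _).le

/-- If `K * Kᴴ` and `Kᴴ * K` are diagonal then `K = p^{1/4} W q^{1/4}` for a partial isometry. -/
lemma exists_quarter_factorization {m n : Type*} [Fintype m] [Fintype n] [DecidableEq m]
    [DecidableEq n] {K : Matrix m n ℂ} {p : m → ℝ} {q : n → ℝ}
    (hp : ∀ i, 0 ≤ p i) (hq : ∀ j, 0 ≤ q j)
    (hKp : K * Kᴴ = Matrix.diagonal fun i => (p i : ℂ))
    (hKq : Kᴴ * K = Matrix.diagonal fun j => (q j : ℂ)) :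
    ∃ W : Matrix m n ℂ,
      K = Matrix.diagonal (fun i => (Real.sqrt (Real.sqrt (p i)) : ℂ)) * W *
        Matrix.diagonal (fun j => (Real.sqrt (Real.sqrt (q j)) : ℂ)) ∧
      W * Wᴴ = Matrix.diagonal (fun i => ((p i / p i : ℝ) : ℂ)) ∧
      Wᴴ * W = Matrix.diagonal (fun j => ((q j / q j : ℝ) : ℂ)) := by
  have hcomm : ∀ i j, (p i : ℂ) * K i j = K i j * q j := by
    intro i j
    rw [← Matrix.diagonal_mul (fun i => (p i : ℂ)) K i j,
      ← Matrix.mul_diagonal (fun j => (q j : ℂ)) K i j, ← hKp, ← hKq, Matrix.mul_assoc]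
  have heq : ∀ i j, K i j ≠ 0 → p i = q j := by
    intro i j h
    have := hcomm i j
    rw [mul_comm] at this
    exact_mod_cast mul_left_cancel₀ h this
  have hne : ∀ i j, K i j ≠ 0 → p i ≠ 0 := by
    intro i j h h0
    have h1 := congrFun (congrFun hKp i) i
    rw [Matrix.diagonal_apply_eq, h0, Complex.ofReal_zero, Matrix.mul_apply] at h1
    simp only [Matrix.conjTranspose_apply, RCLike.star_def, Complex.mul_conj] at h1
    have h2 : ∑ j, Complex.normSq (K i j) = 0 := by exact_mod_cast h1
    rw [Finset.sum_eq_zero_iff_of_nonneg fun _ _ => Complex.normSq_nonneg _] at h2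
    exact h (Complex.normSq_eq_zero.1 (h2 j (Finset.mem_univ j)))
  set D : Matrix m m ℂ := Matrix.diagonal fun i => (((Real.sqrt (p i))⁻¹ : ℝ) : ℂ) with hD
  set E : Matrix n n ℂ := Matrix.diagonal fun j => (((Real.sqrt (q j))⁻¹ : ℝ) : ℂ) with hE
  have hDE : D * K = K * E := by
    ext i j
    rw [hD, hE, Matrix.diagonal_mul, Matrix.mul_diagonal, mul_comm]
    by_cases h : K i j = 0
    · simp [h]
    · rw [heq i j h]
  have hDH : Dᴴ = D := by
    simp [hD, Matrix.diagonal_conjTranspose, Pi.star_def]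
  have hEH : Eᴴ = E := by
    simp [hE, Matrix.diagonal_conjTranspose, Pi.star_def]
  have hinv : ∀ x : ℝ, 0 ≤ x → (Real.sqrt x)⁻¹ * x * (Real.sqrt x)⁻¹ = x / x := by
    intro x hx
    rw [mul_right_comm, ← mul_inv, Real.mul_self_sqrt hx, div_eq_inv_mul]
  refine ⟨D * K, ?_, ?_, ?_⟩
  · ext i j
    rw [Matrix.mul_diagonal, Matrix.diagonal_mul, hD, Matrix.diagonal_mul]
    by_cases h : K i j = 0
    · simp [h]
    · have hpos : 0 < Real.sqrt (p i) := Real.sqrt_pos.2 (lt_of_le_of_ne (hp i) (hne i j h).symm)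
      have h1 : Real.sqrt (Real.sqrt (p i)) * (Real.sqrt (p i))⁻¹ * Real.sqrt (Real.sqrt (p i))
          = 1 := by
        rw [mul_right_comm, Real.mul_self_sqrt hpos.le, mul_inv_cancel₀ hpos.ne']
      have h2 := congrArg (fun x : ℝ => (x : ℂ)) h1
      push_cast at h2
      rw [← heq i j h]
      push_cast
      linear_combination (-K i j) * h2
  · rw [Matrix.conjTranspose_mul, hDH, Matrix.mul_assoc, ← Matrix.mul_assoc K, hKp, hD,
      Matrix.diagonal_mul_diagonal, Matrix.diagonal_mul_diagonal]
    congr 1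
    ext i
    rw [← hinv _ (hp i)]
    push_cast
    ring
  · rw [hDE, Matrix.conjTranspose_mul, hEH, Matrix.mul_assoc, ← Matrix.mul_assoc Kᴴ, hKq, hE,
      Matrix.diagonal_mul_diagonal, Matrix.diagonal_mul_diagonal]
    congr 1
    ext i
    rw [← hinv _ (hq i)]
    push_cast
    ring

lemma normSq_sqrt_conj {n : Type*} [Fintype n] [DecidableEq n] (p : n → ℝ) (X : Matrix n n ℂ)
    (i j : n) :
    Complex.normSq ((Matrix.diagonal (fun i => (Real.sqrt (Real.sqrt (p i)) : ℂ)) * X *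
      Matrix.diagonal (fun i => (Real.sqrt (Real.sqrt (p i)) : ℂ))) i j) =
      Real.sqrt (p i) * Real.sqrt (p j) * Complex.normSq (X i j) := by
  rw [Matrix.mul_diagonal, Matrix.diagonal_mul, Complex.normSq_mul, Complex.normSq_mul,
    Complex.normSq_ofReal, Complex.normSq_ofReal, Real.mul_self_sqrt (Real.sqrt_nonneg _),
    Real.mul_self_sqrt (Real.sqrt_nonneg _)]
  ring

lemma sum_re_trace_le_of_diagonal {ι m n : Type*} [Fintype ι] [Fintype m] [Fintype n]
    [DecidableEq m] [DecidableEq n] {K : Matrix m n ℂ} {p : m → ℝ} {q : n → ℝ}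
    (hp : ∀ i, 0 ≤ p i) (hq : ∀ j, 0 ≤ q j)
    (hKp : K * Kᴴ = Matrix.diagonal fun i => (p i : ℂ))
    (hKq : Kᴴ * K = Matrix.diagonal fun j => (q j : ℂ))
    (A : ι → Matrix m m ℂ) (B : ι → Matrix n n ℂ) :
    ∑ a, (A a * K * B a * Kᴴ).trace.re ≤
      Real.sqrt (∑ a, ∑ i, ∑ j, Real.sqrt (p i) * Real.sqrt (p j) * Complex.normSq (A a i j)) *
      Real.sqrt (∑ a, ∑ i, ∑ j, Real.sqrt (q i) * Real.sqrt (q j) * Complex.normSq (B a i j)) := by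
  obtain ⟨W, hK, hW, hW'⟩ := exists_quarter_factorization hp hq hKp hKq
  simp only [← normSq_sqrt_conj]
  set S : Matrix m m ℂ := Matrix.diagonal fun i => (Real.sqrt (Real.sqrt (p i)) : ℂ) with hS
  set T : Matrix n n ℂ := Matrix.diagonal fun j => (Real.sqrt (Real.sqrt (q j)) : ℂ) with hT
  have hSH : Sᴴ = S := by simp [hS, Matrix.diagonal_conjTranspose, Pi.star_def]
  have hTH : Tᴴ = T := by simp [hT, Matrix.diagonal_conjTranspose, Pi.star_def]
  have htrace : ∀ a, (A a * K * B a * Kᴴ).trace =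
      ((S * A a * S * W) * (T * B a * T * Wᴴ)).trace := by
    intro a
    rw [hK, Matrix.conjTranspose_mul, Matrix.conjTranspose_mul, hSH, hTH]
    rw [show A a * (S * W * T) * B a * (T * (Wᴴ * S)) =
      (A a * S * W * (T * B a * T * Wᴴ)) * S by simp only [Matrix.mul_assoc],
      Matrix.trace_mul_comm]
    simp only [Matrix.mul_assoc]
  simp only [htrace]
  refine (sum_re_trace_mul_le _ _).trans ?_
  refine mul_le_mul (Real.sqrt_le_sqrt (Finset.sum_le_sum fun a _ => ?_))
    (Real.sqrt_le_sqrt (Finset.sum_le_sum fun a _ => ?_)) (Real.sqrt_nonneg _) (Real.sqrt_nonneg _)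
  · exact sum_normSq_mul_le _ hW fun i => div_self_le_one (p i)
  · exact sum_normSq_mul_le _ (W := Wᴴ)
      (by rw [Matrix.conjTranspose_conjTranspose]; exact hW') fun j => div_self_le_one (q j)

/-- Cauchy–Schwarz via canonical purifications (Lemma `psi-cs`):
`Σ_a ⟨ψ| A_a ⊗ B_a |ψ⟩ ≤ (Σ_a ⟨ψ_A| A_a ⊗ A_aᵀ |ψ_A⟩)^{1/2} (Σ_a ⟨ψ_B| B_a ⊗ B_aᵀ |ψ_B⟩)^{1/2}`. -/
theorem stmt3 {n₁ n₂ 𝒜 : Type*} [Fintype n₁] [DecidableEq n₁] [Fintype n₂] [DecidableEq n₂]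
    [Fintype 𝒜]
    (ψ : n₁ × n₂ → ℂ) (hψ : nsq ψ = 1)
    (A : 𝒜 → Matrix n₁ n₁ ℂ) (B : 𝒜 → Matrix n₂ n₂ ℂ)
    (hA : IsPOVM A) (hB : IsPOVM B)
    (UA : Matrix n₁ n₁ ℂ) (lamA : n₁ → ℝ) (hUA : UAᴴ * UA = 1) (hlamA : ∀ i, 0 ≤ lamA i)
    (hdecA : rhoA ψ = UA * Matrix.diagonal (fun i => (lamA i : ℂ)) * UAᴴ)
    (UB : Matrix n₂ n₂ ℂ) (lamB : n₂ → ℝ) (hUB : UBᴴ * UB = 1) (hlamB : ∀ i, 0 ≤ lamB i)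
    (hdecB : rhoB ψ = UB * Matrix.diagonal (fun i => (lamB i : ℂ)) * UBᴴ) :
    ∑ a, ev ψ (A a ⊗ₖ B a) ≤
      Real.sqrt (∑ a, ev (purif UA lamA) (A a ⊗ₖ transposeB UA (A a))) *
      Real.sqrt (∑ a, ev (purif UB lamB) (B a ⊗ₖ transposeB UB (B a))) := by
  have hUA' : UA * UAᴴ = 1 := mul_eq_one_comm.1 hUA
  have hUB' : UB * UBᴴ = 1 := mul_eq_one_comm.1 hUB
  obtain ⟨φ, rfl⟩ : ∃ φ, ψ = (UA ⊗ₖ UB) *ᵥ φ :=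
    ⟨(UAᴴ ⊗ₖ UBᴴ) *ᵥ ψ, by
      rw [Matrix.mulVec_mulVec, ← Matrix.mul_kronecker_mul, hUA', hUB', Matrix.one_kronecker_one,
        Matrix.one_mulVec]⟩
  have hTH : UBᵀᴴ = UBᴴᵀ := rfl
  have hUBT : UBᵀ * UBᵀᴴ = 1 := by
    rw [hTH, ← Matrix.transpose_mul, hUB, Matrix.transpose_one]
  have hKp : coeffMat φ * (coeffMat φ)ᴴ = Matrix.diagonal fun i => (lamA i : ℂ) := by
    rw [rhoA_eq_coeffMat, coeffMat_kronecker_mulVec] at hdecA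
    calc coeffMat φ * (coeffMat φ)ᴴ
        = (UAᴴ * UA) * coeffMat φ * (UBᵀ * UBᵀᴴ) * (coeffMat φ)ᴴ * (UAᴴ * UA) := by
          simp [hUA, hUBT]
      _ = UAᴴ * (UA * coeffMat φ * UBᵀ * (UA * coeffMat φ * UBᵀ)ᴴ) * UA := by
          simp only [Matrix.conjTranspose_mul, Matrix.mul_assoc]
      _ = (UAᴴ * UA) * (Matrix.diagonal fun i => (lamA i : ℂ)) * (UAᴴ * UA) := by
          rw [hdecA]; simp only [Matrix.mul_assoc]
      _ = _ := by simp [hUA]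
  have hKq : (coeffMat φ)ᴴ * coeffMat φ = Matrix.diagonal fun j => (lamB j : ℂ) := by
    rw [rhoB_eq_coeffMat, coeffMat_kronecker_mulVec] at hdecB
    rw [← Matrix.diagonal_transpose, ← Matrix.transpose_transpose (_ * _)]
    congr 1
    calc ((coeffMat φ)ᴴ * coeffMat φ)ᵀ
        = (UBᴴ * UB) * ((coeffMat φ)ᴴ * (UAᴴ * UA) * coeffMat φ)ᵀ * (UBᴴ * UB) := by
          simp [hUA, hUB]
      _ = UBᴴ * ((UA * coeffMat φ * UBᵀ)ᴴ * (UA * coeffMat φ * UBᵀ))ᵀ * UB := by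
          simp only [Matrix.conjTranspose_mul, Matrix.transpose_mul, Matrix.mul_assoc,
            hTH, Matrix.transpose_transpose]
      _ = (UBᴴ * UB) * (Matrix.diagonal fun i => (lamB i : ℂ)) * (UBᴴ * UB) := by
          rw [hdecB]; simp only [Matrix.mul_assoc]
      _ = _ := by simp [hUB]
  have hT : ∀ a, ∑ i, ∑ j, Real.sqrt (lamB i) * Real.sqrt (lamB j) *
      Complex.normSq ((UBᴴ * B a * UB) i j) = ∑ i, ∑ j, Real.sqrt (lamB i) * Real.sqrt (lamB j) *
      Complex.normSq ((UBᴴ * B a * UB)ᵀ i j) := by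
    intro a
    rw [Finset.sum_comm]
    simp only [Matrix.transpose_apply, mul_comm (Real.sqrt _) (Real.sqrt _)]
  simp only [ev_purif hUA lamA (hA.1 _).isHermitian, ev_purif hUB lamB (hB.1 _).isHermitian, hT,
    ev_mulVec, Matrix.conjTranspose_kronecker, ← Matrix.mul_kronecker_mul, ev_kronecker]
  exact sum_re_trace_le_of_diagonal hlamA hlamB hKp hKq _ _


end AlmostSync
end
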